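/- Mean force discretization error bound of higher order: Suppose U satisfies assumptions A1–A2 with constant L > 0 and let h > 0 satisfy L^{1/2}·h ≤ 1/12. Then for all x, v ∈ ℝ^d, | (1/h)·∫₀^h ( ∇U(q_s(x,v)) − ∇U(x + s·v) ) ds |² ≤ (L³·h⁴/12)·( L·|x|² + |v|² ). -/

import Mathlib

open MeasureTheory ProbabilityTheory Real
open scoped ENNReal RealInnerProductSpace

noncomputable section

variable {d : ℕ}

/-- The Hamiltonian position deviates from free transport by at most `C * t ^ 2 / 2` when the force
is bounded by `C`. -/
theorem norm_sub_free_transport_le {E : Type*} [NormedAddCommGroup E] [NormedSpace ℝ E]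
    {q p F : ℝ → E} {C h : ℝ}
    (hq : ∀ t, HasDerivAt q (p t) t) (hp : ∀ t, HasDerivAt p (F t) t)
    (hF : ∀ t ∈ Set.Icc 0 h, ‖F t‖ ≤ C) {t : ℝ} (ht : t ∈ Set.Icc 0 h) :
    ‖q t - (q 0 + t • p 0)‖ ≤ C * t ^ 2 / 2 := by
  have hpt : ∀ s ∈ Set.Icc 0 h, ‖p s - p 0‖ ≤ C * s := fun s hs => by
    simpa using norm_image_sub_le_of_norm_deriv_le_segment'
      (fun t _ => (hp t).hasDerivWithinAt) (fun t ht => hF t (Set.Ico_subset_Icc_self ht)) s hs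
  have hd : ∀ s, HasDerivAt (fun s => q s - (q 0 + s • p 0)) (p s - p 0) s := fun s => by
    have hlin := ((hasDerivAt_id s).smul_const (p 0)).const_add (q 0)
    rw [one_smul] at hlin
    exact (hq s).sub hlin
  have hB : ∀ s, HasDerivAt (fun s : ℝ => C * s ^ 2 / 2) (C * s) s := fun s => by
    refine (((hasDerivAt_pow 2 s).const_mul C).div_const 2).congr_deriv ?_
    push_cast
    ring
  exact image_norm_le_of_norm_deriv_right_le_deriv_boundary
    (fun s _ => (hd s).continuousAt.continuousWithinAt)
    (fun s _ => (hd s).hasDerivWithinAt) (by simp) hB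
    (fun s hs => hpt s (Set.Ico_subset_Icc_self hs)) ht

/-- A gradient vanishes at a global minimum. -/
theorem gradient_eq_zero_of_forall_le {E : Type*} [NormedAddCommGroup E] [InnerProductSpace ℝ E]
    [CompleteSpace E] {U : E → ℝ} {g a : E} (hg : HasGradientAt U g a) (hmin : ∀ x, U a ≤ U x) :
    g = 0 := by
  have hloc : IsLocalMin U a := Filter.Eventually.of_forall hmin
  simpa using hloc.hasFDerivAt_eq_zero hg.hasFDerivAt

/-- **Mean force discretization error bound of higher order**
(from the proof of Lemma B.4, eq. (B.15)): under A1–A2 with `L^{1/2}·h ≤ 1/12`,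
`|(1/h)∫₀ʰ (∇U(q_s(x,v)) - ∇U(x + s·v)) ds|² ≤ (L³·h⁴/12)·(L·|x|² + |v|²)`. -/
theorem mean_force_discretization_error
    (U : EuclideanSpace ℝ (Fin d) → ℝ)
    (gU : EuclideanSpace ℝ (Fin d) → EuclideanSpace ℝ (Fin d)) (L : ℝ) (hL : 0 < L)
    (hgrad : ∀ x, HasGradientAt U (gU x) x)
    (hU0 : U 0 = 0) (hUmin : ∀ x, U 0 ≤ U x)
    (hLip : ∀ x y, ‖gU x - gU y‖ ≤ L * ‖x - y‖)
    (h : ℝ) (hh : 0 < h) (hLh : Real.sqrt L * h ≤ 1 / 12)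
    (x v : EuclideanSpace ℝ (Fin d))
    (q p : ℝ → EuclideanSpace ℝ (Fin d)) (hq0 : q 0 = x) (hp0 : p 0 = v)
    (hq : ∀ t, HasDerivAt q (p t) t) (hp : ∀ t, HasDerivAt p (-gU (q t)) t)
 :
    ‖h⁻¹ • ∫ s in Set.Ioc (0 : ℝ) h, (gU (q s) - gU (x + s • v))‖ ^ 2
      ≤ L ^ 3 * h ^ 4 / 12 * (L * ‖x‖ ^ 2 + ‖v‖ ^ 2) := by
  have hg0 : gU 0 = 0 := gradient_eq_zero_of_forall_le (hgrad 0) hUmin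
  have hgle : ∀ y, ‖gU y‖ ≤ L * ‖y‖ := fun y => by simpa [hg0] using hLip y 0
  have hqc : Continuous q := continuous_iff_continuousAt.2 fun t => (hq t).continuousAt
  have hgc : Continuous gU :=
    (LipschitzWith.of_dist_le' fun x y => by simpa [dist_eq_norm] using hLip x y).continuous
  obtain ⟨r, hr, hmax⟩ := isCompact_Icc.exists_isMaxOn (Set.nonempty_Icc.2 hh.le)
    (hqc.norm.continuousOn (s := Set.Icc 0 h))
  set m := ‖q r‖
  have hm0 : 0 ≤ m := norm_nonneg _
  have hdev : ∀ t ∈ Set.Icc 0 h, ‖q t - (x + t • v)‖ ≤ L * m * t ^ 2 / 2 := fun t ht => by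
    subst hq0 hp0
    refine norm_sub_free_transport_le hq hp (fun s hs => ?_) ht
    rw [norm_neg]
    exact (hgle _).trans (mul_le_mul_of_nonneg_left (hmax hs) hL.le)
  have hLh2 : L * h ^ 2 ≤ 1 / 144 := by
    have := pow_le_pow_left₀ (by positivity) hLh 2
    rw [mul_pow, Real.sq_sqrt hL.le] at this
    linarith
  have hmle : m * (287 / 288) ≤ ‖x‖ + h * ‖v‖ := by
    have h1 : m ≤ ‖x‖ + r * ‖v‖ + L * m * r ^ 2 / 2 := by
      calc m = ‖(x + r • v) + (q r - (x + r • v))‖ := by rw [add_sub_cancel]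
        _ ≤ ‖x‖ + ‖r • v‖ + ‖q r - (x + r • v)‖ :=
          (norm_add_le _ _).trans (add_le_add_left (norm_add_le _ _) _)
        _ ≤ _ := by
          rw [norm_smul, Real.norm_of_nonneg hr.1]
          gcongr
          exact hdev r hr
    have h2 : r * ‖v‖ ≤ h * ‖v‖ := by gcongr; exact hr.2
    have h3 : L * m * r ^ 2 ≤ m / 144 := by
      calc L * m * r ^ 2 ≤ L * m * h ^ 2 := by gcongr; exacts [hr.1, hr.2]
        _ = m * (L * h ^ 2) := by ring
        _ ≤ m * (1 / 144) := by gcongr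
        _ = m / 144 := by ring
    linarith
  have hint : ‖∫ s in Set.Ioc (0 : ℝ) h, (gU (q s) - gU (x + s • v))‖ ≤ L ^ 2 * m * h ^ 3 / 6 := by
    rw [← intervalIntegral.integral_of_le hh.le]
    calc _ ≤ ∫ s in (0 : ℝ)..h, L ^ 2 * m / 2 * s ^ 2 := by
          refine intervalIntegral.norm_integral_le_of_norm_le hh.le
            (Filter.Eventually.of_forall fun s hs => ?_)
            (Continuous.intervalIntegrable (by fun_prop) _ _)
          calc _ ≤ L * ‖q s - (x + s • v)‖ := hLip _ _
            _ ≤ L * (L * m * s ^ 2 / 2) := by gcongr; exact hdev s (Set.Ioc_subset_Icc_self hs)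
            _ = _ := by ring
      _ = _ := by
          rw [intervalIntegral.integral_const_mul, integral_pow]
          ring
  have hmean : ‖h⁻¹ • ∫ s in Set.Ioc (0 : ℝ) h, (gU (q s) - gU (x + s • v))‖
      ≤ L ^ 2 * m * h ^ 2 / 6 := by
    rw [norm_smul, Real.norm_of_nonneg (by positivity)]
    calc _ ≤ h⁻¹ * (L ^ 2 * m * h ^ 3 / 6) := by gcongr
      _ = _ := by field_simp
  have hm2 : L * m ^ 2 ≤ 3 * (L * ‖x‖ ^ 2 + ‖v‖ ^ 2) := by
    have h1 := pow_le_pow_left₀ (by positivity) hmle 2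
    have h2 : m ^ 2 ≤ 3 * (‖x‖ ^ 2 + h ^ 2 * ‖v‖ ^ 2) := by
      nlinarith [sq_nonneg (‖x‖ - h * ‖v‖)]
    have h3 : L * h ^ 2 * ‖v‖ ^ 2 ≤ 1 * ‖v‖ ^ 2 := by gcongr; linarith
    nlinarith [mul_le_mul_of_nonneg_left h2 hL.le]
  calc _ ≤ (L ^ 2 * m * h ^ 2 / 6) ^ 2 := by gcongr
    _ = L ^ 3 * h ^ 4 / 36 * (L * m ^ 2) := by ring
    _ ≤ L ^ 3 * h ^ 4 / 36 * (3 * (L * ‖x‖ ^ 2 + ‖v‖ ^ 2)) := by gcongr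
    _ = _ := by ring

end
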